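/- Fix λ > 0. Let E_n denote the expectation of rank_λ(σ) over σ chosen uniformly at random from S_n(123). Then: (i) for λ = 1, the expectation of rank_1 over a uniform element of S_n(123) equals the expectation of rank_1 over a uniform element of S_n(132), for every n; (ii) for every c_1 > 0 and every ε ∈ (0, 1/2), there exists a constant c_2 > 0 such that for all sufficiently large n, n/(λ+1) − c_1·n^{1/2+ε} ≤ E_n ≤ n/(λ+1) − c_2·√n. -/

import Mathlib

open Filter Finset Real

/-- `σ` contains the pattern `τ`. -/
def ContainsPattern {n m : ℕ} (σ : Equiv.Perm (Fin n)) (τ : Equiv.Perm (Fin m)) : Prop :=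
  ∃ f : Fin m → Fin n, StrictMono f ∧ ∀ a b : Fin m, σ (f a) < σ (f b) ↔ τ a < τ b

/-- `σ` avoids the pattern `τ`. -/
def Avoids {n m : ℕ} (σ : Equiv.Perm (Fin n)) (τ : Equiv.Perm (Fin m)) : Prop :=
  ¬ ContainsPattern σ τ

/-- The pattern (1,2,3) ∈ S₃ (0-indexed: 0,1,2). -/
def pattern123 : Equiv.Perm (Fin 3) := 1

/-- The pattern (1,3,2) ∈ S₃ (0-indexed: 0,2,1). -/
def pattern132 : Equiv.Perm (Fin 3) := Equiv.swap 1 2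

/-- The pattern (3,2,1) ∈ S₃ (0-indexed: 2,1,0). -/
def pattern321 : Equiv.Perm (Fin 3) := Equiv.swap 0 2

/-- The pattern (2,3,1) ∈ S₃ (0-indexed: 1,2,0). -/
def pattern231 : Equiv.Perm (Fin 3) := (Equiv.swap 1 2).trans (Equiv.swap 0 1)

attribute [local instance] Classical.propDecidable

/-- `rank_λ(σ)`: the largest `r ≥ 0` with `σ(i) > λ·r` for all `1 ≤ i ≤ r` (1-indexed). -/
noncomputable def rankStat {n : ℕ} (lam : ℝ) (σ : Equiv.Perm (Fin n)) : ℕ :=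
  sSup {r : ℕ | ∀ i : Fin n, (i : ℕ) + 1 ≤ r → lam * r < (σ i : ℕ) + 1}

/-- The expectation of `rank_λ` over a uniformly random `123`-avoiding permutation. -/
noncomputable def ERank123 (lam : ℝ) (n : ℕ) : ℝ :=
  (∑ σ ∈ Finset.univ.filter (fun σ : Equiv.Perm (Fin n) => Avoids σ pattern123),
      (rankStat lam σ : ℝ)) /
    (Finset.univ.filter (fun σ : Equiv.Perm (Fin n) => Avoids σ pattern123)).card

/-- The expectation of `rank_λ` over a uniformly random `132`-avoiding permutation. -/
noncomputable def ERank132 (lam : ℝ) (n : ℕ) : ℝ :=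
  (∑ σ ∈ Finset.univ.filter (fun σ : Equiv.Perm (Fin n) => Avoids σ pattern132),
      (rankStat lam σ : ℝ)) /
    (Finset.univ.filter (fun σ : Equiv.Perm (Fin n) => Avoids σ pattern132)).card


/-- prefix minimum -/
noncomputable def pm {n : ℕ} (σ : Equiv.Perm (Fin n)) (i : Fin n) : Fin n :=
  (Finset.Iic i).inf' ⟨i, by simp⟩ σ

lemma pm_le {n : ℕ} (σ : Equiv.Perm (Fin n)) {i j : Fin n} (h : j ≤ i) : pm σ i ≤ σ j :=
  Finset.inf'_le _ (by simpa using h)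

lemma exists_pm {n : ℕ} (σ : Equiv.Perm (Fin n)) (i : Fin n) : ∃ j ≤ i, σ j = pm σ i := by
  obtain ⟨j, hj, h⟩ := Finset.exists_mem_eq_inf' (s := Finset.Iic i) ⟨i, by simp⟩ σ
  exact ⟨j, by simpa using hj, h.symm⟩

lemma pm_eq {n : ℕ} (σ : Equiv.Perm (Fin n)) (i m : Fin n) (h1 : ∀ j ≤ i, m ≤ σ j)
    (h2 : ∃ j ≤ i, σ j = m) : pm σ i = m := by
  obtain ⟨j, hj, e⟩ := h2
  obtain ⟨k, hk, e'⟩ := exists_pm σ i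
  apply le_antisymm
  · rw [← e]; exact pm_le σ hj
  · rw [← e']; exact h1 k hk

lemma pm_antitone {n : ℕ} (σ : Equiv.Perm (Fin n)) : Antitone (pm σ) := by
  intro i j h
  obtain ⟨k, hk, e⟩ := exists_pm σ i
  rw [← e]; exact pm_le σ (hk.trans h)

lemma pm_bound {n : ℕ} (σ : Equiv.Perm (Fin n)) (i : Fin n) : (pm σ i : ℕ) + i < n := by
  have h : ((Finset.Iic i).image σ) ⊆ Finset.Ici (pm σ i) := by
    intro x hx
    simp only [Finset.mem_image, Finset.mem_Iic] at hx
    obtain ⟨j, hj, rfl⟩ := hx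
    simpa using pm_le σ hj
  have := Finset.card_le_card h
  rw [Finset.card_image_of_injective _ σ.injective, Fin.card_Iic, Fin.card_Ici] at this
  have := (pm σ i).2
  omega

lemma avoids123_iff {n : ℕ} (σ : Equiv.Perm (Fin n)) :
    Avoids σ pattern123 ↔ ∀ a b c, a < b → b < c → σ a < σ b → ¬ σ b < σ c := by
  unfold Avoids ContainsPattern pattern123
  constructor
  · intro h a b c hab hbc h1 h2
    apply h
    refine ⟨![a, b, c], ?_, ?_⟩
    · intro x y hxy
      fin_cases x <;> fin_cases y <;> simp_all <;> exact hab.trans hbc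
    · intro x y
      have h3 := h1.trans h2
      fin_cases x <;> fin_cases y <;> simp [h1, h2, h3, h1.le, h2.le, h3.le]
  · rintro h ⟨f, hf, hp⟩
    refine h (f 0) (f 1) (f 2) (hf (by decide)) (hf (by decide)) ((hp 0 1).2 (by decide))
      ((hp 1 2).2 (by decide))

lemma avoids132_iff {n : ℕ} (σ : Equiv.Perm (Fin n)) :
    Avoids σ pattern132 ↔ ∀ a b c, a < b → b < c → σ a < σ c → ¬ σ c < σ b := by
  unfold Avoids ContainsPattern pattern132
  constructor
  · intro h a b c hab hbc h1 h2
    apply h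
    refine ⟨![a, b, c], ?_, ?_⟩
    · intro x y hxy
      fin_cases x <;> fin_cases y <;> simp_all <;> exact hab.trans hbc
    · intro x y
      have h3 := h1.trans h2
      fin_cases x <;> fin_cases y <;>
        simp [h1, h2, h3, h1.le, h2.le, h3.le, Equiv.swap_apply_def]
  · rintro h ⟨f, hf, hp⟩
    refine h (f 0) (f 1) (f 2) (hf (by decide)) (hf (by decide)) ((hp 0 2).2 (by decide))
      ((hp 2 1).2 (by decide))

lemma pm_swap_le {n : ℕ} (σ : Equiv.Perm (Fin n)) {a b c : Fin n} (hab : a < b) (hbc : b < c)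
    (h1 : σ a < σ b) (h2 : σ a < σ c) (i : Fin n) : pm (σ * Equiv.swap b c) i ≤ pm σ i := by
  obtain ⟨j, hj, e⟩ := exists_pm σ i
  have key : j ≠ b ∧ j ≠ c := by
    constructor
    · rintro rfl
      have := pm_le σ (hab.le.trans hj)
      rw [← e] at this
      exact absurd h1 (not_lt.2 this)
    · rintro rfl
      have := pm_le σ ((hab.trans hbc).le.trans hj)
      rw [← e] at this
      exact absurd h2 (not_lt.2 this)
  have := pm_le (σ * Equiv.swap b c) hj
  rwa [Equiv.Perm.mul_apply, Equiv.swap_apply_of_ne_of_ne key.1 key.2, e] at this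

lemma pm_swap {n : ℕ} (σ : Equiv.Perm (Fin n)) {a b c : Fin n} (hab : a < b) (hbc : b < c)
    (h1 : σ a < σ b) (h2 : σ a < σ c) : pm (σ * Equiv.swap b c) = pm σ := by
  funext i
  apply le_antisymm (pm_swap_le σ hab hbc h1 h2 i)
  have h := pm_swap_le (σ * Equiv.swap b c) hab hbc
    (by simpa [Equiv.swap_apply_of_ne_of_ne hab.ne (hab.trans hbc).ne] using h2)
    (by simpa [Equiv.swap_apply_of_ne_of_ne hab.ne (hab.trans hbc).ne] using h1) i
  simpa [mul_assoc] using h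

/-- potential -/
def pot {n : ℕ} (σ : Equiv.Perm (Fin n)) : ℤ := ∑ i : Fin n, ((i : ℕ) : ℤ) * ((σ i : ℕ) : ℤ)

lemma pot_swap {n : ℕ} (σ : Equiv.Perm (Fin n)) {b c : Fin n} (hbc : b < c) :
    pot (σ * Equiv.swap b c) - pot σ = (((c : ℕ) : ℤ) - (b : ℕ)) * (((σ b : ℕ) : ℤ) - (σ c : ℕ)) := by
  unfold pot
  rw [← Equiv.sum_comp (Equiv.swap b c)
    (fun i => ((i : ℕ) : ℤ) * (((σ * Equiv.swap b c) i : ℕ) : ℤ)), ← Finset.sum_sub_distrib,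
    Fintype.sum_eq_add b c hbc.ne]
  · simp; ring
  · rintro x ⟨h1, h2⟩
    simp [Equiv.swap_apply_of_ne_of_ne h1 h2]

lemma exists_avoid123 {n : ℕ} (σ : Equiv.Perm (Fin n)) :
    ∃ τ : Equiv.Perm (Fin n), Avoids τ pattern123 ∧ pm τ = pm σ := by
  obtain ⟨τ, hτ, hmin⟩ := Finset.exists_min_image
    (Finset.univ.filter (fun τ : Equiv.Perm (Fin n) => pm τ = pm σ)) pot ⟨σ, by simp⟩
  simp only [Finset.mem_filter, Finset.mem_univ, true_and] at hτ hmin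
  refine ⟨τ, (avoids123_iff τ).2 ?_, hτ⟩
  intro a b c hab hbc h1 h2
  have h3 := hmin (τ * Equiv.swap b c) ((pm_swap τ hab hbc h1 (h1.trans h2)).trans hτ)
  have h4 := pot_swap τ hbc
  have h5 : (((c : ℕ) : ℤ) - (b : ℕ)) > 0 := by have : (b : ℕ) < c := hbc; omega
  have h6 : (((τ c : ℕ) : ℤ) - (τ b : ℕ)) > 0 := by have : (τ b : ℕ) < τ c := h2; omega
  nlinarith [mul_pos h5 h6]

lemma exists_avoid132 {n : ℕ} (σ : Equiv.Perm (Fin n)) :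
    ∃ τ : Equiv.Perm (Fin n), Avoids τ pattern132 ∧ pm τ = pm σ := by
  obtain ⟨τ, hτ, hmin⟩ := Finset.exists_max_image
    (Finset.univ.filter (fun τ : Equiv.Perm (Fin n) => pm τ = pm σ)) pot ⟨σ, by simp⟩
  simp only [Finset.mem_filter, Finset.mem_univ, true_and] at hτ hmin
  refine ⟨τ, (avoids132_iff τ).2 ?_, hτ⟩
  intro a b c hab hbc h1 h2
  have h3 := hmin (τ * Equiv.swap b c) ((pm_swap τ hab hbc (h1.trans h2) h1).trans hτ)
  have h4 := pot_swap τ hbc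
  have h5 : (((c : ℕ) : ℤ) - (b : ℕ)) > 0 := by have : (b : ℕ) < c := hbc; omega
  have h6 : (((τ b : ℕ) : ℤ) - (τ c : ℕ)) > 0 := by have : (τ c : ℕ) < τ b := h2; omega
  nlinarith [mul_pos h5 h6]

/-- At the first difference, the smaller perm has a 123 and the larger one a 132. -/
lemma first_diff {n : ℕ} {σ τ : Equiv.Perm (Fin n)} (h : pm σ = pm τ) {i : Fin n}
    (hlt : σ i < τ i) (hi : ∀ j < i, σ j = τ j) :
    ¬ Avoids σ pattern123 ∧ ¬ Avoids τ pattern132 := by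
  have hna : ∃ a < i, σ a < σ i := by
    obtain ⟨a, ha, e⟩ := exists_pm τ i
    rcases ha.lt_or_eq with ha' | rfl
    · refine ⟨a, ha', ?_⟩
      have h1 := pm_le σ (le_refl i)
      rw [h, ← e, ← hi a ha'] at h1
      exact lt_of_le_of_ne h1 (fun hh => ha'.ne (σ.injective hh))
    · have h1 := pm_le σ (le_refl a)
      rw [h, ← e] at h1
      exact absurd hlt (not_lt.2 h1)
  obtain ⟨a, ha, haσ⟩ := hna
  constructor
  · rw [avoids123_iff]; push Not
    refine ⟨a, i, σ.symm (τ i), ha, ?_, haσ, by simpa using hlt⟩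
    by_contra hc
    rcases (not_lt.1 hc).lt_or_eq with h' | h'
    · have := hi _ h'
      rw [Equiv.apply_symm_apply] at this
      exact h'.ne (τ.injective this.symm)
    · have := congrArg σ h'
      rw [Equiv.apply_symm_apply] at this
      exact hlt.ne this.symm
  · rw [avoids132_iff]; push Not
    refine ⟨a, i, τ.symm (σ i), ha, ?_, by rw [← hi a ha]; simpa using haσ, by simpa using hlt⟩
    by_contra hc
    rcases (not_lt.1 hc).lt_or_eq with h' | h'
    · have := hi _ h'
      rw [Equiv.apply_symm_apply] at this
      exact h'.ne (σ.injective this)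
    · have := congrArg τ h'
      rw [Equiv.apply_symm_apply] at this
      exact hlt.ne this

lemma exists_first_diff {n : ℕ} {σ τ : Equiv.Perm (Fin n)} (h : σ ≠ τ) :
    ∃ i, σ i ≠ τ i ∧ ∀ j < i, σ j = τ j := by
  have hne : (Finset.univ.filter (fun i => σ i ≠ τ i)).Nonempty := by
    by_contra hc
    rw [Finset.not_nonempty_iff_eq_empty, Finset.filter_eq_empty_iff] at hc
    exact h (Equiv.ext fun x => not_not.1 (hc (Finset.mem_univ x)))
  obtain ⟨i, hi, hmin⟩ := Finset.exists_min_image _ id hne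
  refine ⟨i, by simpa using hi, fun j hj => ?_⟩
  by_contra hc
  exact absurd hj (not_lt.2 (hmin j (by simpa using hc)))

lemma inj123 {n : ℕ} {σ τ : Equiv.Perm (Fin n)} (hσ : Avoids σ pattern123)
    (hτ : Avoids τ pattern123) (h : pm σ = pm τ) : σ = τ := by
  by_contra hne
  obtain ⟨i, hi, hj⟩ := exists_first_diff hne
  rcases lt_or_gt_of_ne hi with hl | hl
  · exact (first_diff h hl hj).1 hσ
  · exact (first_diff h.symm hl (fun j hh => (hj j hh).symm)).1 hτ

lemma inj132 {n : ℕ} {σ τ : Equiv.Perm (Fin n)} (hσ : Avoids σ pattern132)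
    (hτ : Avoids τ pattern132) (h : pm σ = pm τ) : σ = τ := by
  by_contra hne
  obtain ⟨i, hi, hj⟩ := exists_first_diff hne
  rcases lt_or_gt_of_ne hi with hl | hl
  · exact (first_diff h hl hj).2 hτ
  · exact (first_diff h.symm hl (fun j hh => (hj j hh).symm)).2 hσ

lemma rank_set_iff {n : ℕ} (lam : ℝ) (σ : Equiv.Perm (Fin n)) (r : ℕ) :
    (∀ i : Fin n, (i : ℕ) + 1 ≤ r → lam * r < (σ i : ℕ) + 1) ↔
    (∀ i : Fin n, (i : ℕ) + 1 ≤ r → lam * r < (pm σ i : ℕ) + 1) := by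
  constructor
  · intro h i hi
    obtain ⟨j, hj, e⟩ := exists_pm σ i
    rw [← e]
    have : (j : ℕ) ≤ i := hj
    exact h j (by omega)
  · intro h i hi
    refine (h i hi).trans_le ?_
    have : (pm σ i : ℕ) ≤ σ i := pm_le σ le_rfl
    exact_mod_cast Nat.succ_le_succ this

lemma rankStat_eq {n : ℕ} (lam : ℝ) (σ : Equiv.Perm (Fin n)) :
    rankStat lam σ = sSup {r : ℕ | ∀ i : Fin n, (i : ℕ) + 1 ≤ r → lam * r < (pm σ i : ℕ) + 1} := by
  unfold rankStat
  simp_rw [rank_set_iff lam σ]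

lemma part_one (lam : ℝ) (n : ℕ) : ERank123 lam n = ERank132 lam n := by
  unfold ERank123 ERank132
  have key : ∀ (P : Equiv.Perm (Fin n) → Prop)
      (_ : ∀ σ τ, P σ → P τ → pm σ = pm τ → σ = τ)
      (_ : ∀ σ : Equiv.Perm (Fin n), ∃ τ, P τ ∧ pm τ = pm σ) (f : (Fin n → Fin n) → ℝ),
      ∑ σ ∈ Finset.univ.filter P, f (pm σ) =
        ∑ m ∈ Finset.univ.image (pm : Equiv.Perm (Fin n) → _), f m := by
    intro P h1 h2 f
    have : Finset.univ.image (pm : Equiv.Perm (Fin n) → _) = (Finset.univ.filter P).image pm := by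
      ext m
      simp only [Finset.mem_image, Finset.mem_univ, true_and, Finset.mem_filter]
      constructor
      · rintro ⟨σ, rfl⟩; exact h2 σ
      · rintro ⟨σ, _, h⟩; exact ⟨σ, h⟩
    rw [this, Finset.sum_image]
    intro σ hσ τ hτ h
    simp only [Finset.coe_filter, Finset.mem_univ, true_and, Set.mem_setOf_eq] at hσ hτ
    exact h1 σ τ hσ hτ h
  have k1 := key (fun σ => Avoids σ pattern123) (fun _ _ => inj123) exists_avoid123
  have k2 := key (fun σ => Avoids σ pattern132) (fun _ _ => inj132) exists_avoid132
  have e1 := (k1 (fun _ => 1)).trans (k2 (fun _ => 1)).symm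
  simp only [Finset.sum_const, nsmul_eq_mul, mul_one] at e1
  rw [e1]
  congr 1
  simp_rw [rankStat_eq]
  exact (k1 (fun m => ((sSup {r : ℕ | ∀ i : Fin n, (i : ℕ) + 1 ≤ r → lam * r < (m i : ℕ) + 1} : ℕ) : ℝ))).trans (k2 _).symm

lemma exists_perm_pm : ∀ (n : ℕ) (m : Fin n → ℕ), Antitone m → (∀ i, m i + i < n) →
    ∃ σ : Equiv.Perm (Fin n), ∀ i, (pm σ i : ℕ) = m i := by
  intro n
  induction n with
  | zero => intro m _ _; exact ⟨1, fun i => i.elim0⟩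
  | succ n ih =>
    intro m hm hb
    have hne : (Finset.univ.filter (fun i => m i = 0)).Nonempty :=
      ⟨Fin.last n, by have := hb (Fin.last n); simp at this ⊢; omega⟩
    obtain ⟨p, hp, hmin⟩ := Finset.exists_min_image _ id hne
    simp only [Finset.mem_filter, Finset.mem_univ, true_and, id] at hp hmin
    have hpos : ∀ i < p, 1 ≤ m i := by
      intro i hi
      by_contra hc
      exact absurd hi (not_lt.2 (hmin i (by omega)))
    obtain ⟨τ, hτ⟩ := ih (fun i => if i.castSucc < p then m i.castSucc - 1 else 0) (by
        intro i j hij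
        have h1 := hm (show i.castSucc ≤ j.castSucc from hij)
        have h2 : (i.castSucc : Fin (n+1)) ≤ j.castSucc := hij
        simp only
        split_ifs with h3 h4
        · omega
        · exact absurd (h2.trans_lt h3) h4
        · omega
        · omega) (by
        intro i
        have h1 := hb i.castSucc
        simp only [Fin.val_castSucc] at h1
        split_ifs with h3
        · have := hpos _ h3; omega
        · have := i.2; omega)
    let σ : Equiv.Perm (Fin (n+1)) :=
      (finSuccEquiv' p).trans ((Equiv.optionCongr τ).trans (finSuccEquiv' 0).symm)
    have s1 : σ p = 0 := by simp [σ]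
    have s2 : ∀ k, σ (p.succAbove k) = (τ k).succ := by intro k; simp [σ]
    refine ⟨σ, fun i => ?_⟩
    by_cases hi : i < p
    · obtain ⟨i', rfl⟩ := Fin.exists_castSucc_eq.2 (show i ≠ Fin.last n from
        (hi.trans_le (Fin.le_last p)).ne)
      have : pm σ i'.castSucc = (pm τ i').succ := by
        apply pm_eq
        · intro j hj
          obtain ⟨j', rfl⟩ := Fin.exists_castSucc_eq.2 (show j ≠ Fin.last n from
            (hj.trans_lt (hi.trans_le (Fin.le_last p))).ne)
          have := s2 j'
          rw [Fin.succAbove_of_castSucc_lt _ _ (hj.trans_lt hi)] at this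
          rw [this]
          exact Fin.succ_le_succ_iff.2 (pm_le τ hj)
        · obtain ⟨j', hj', e⟩ := exists_pm τ i'
          have hj : j'.castSucc ≤ i'.castSucc := hj'
          refine ⟨j'.castSucc, hj, ?_⟩
          have := s2 j'
          rw [Fin.succAbove_of_castSucc_lt _ _ (hj.trans_lt hi)] at this
          rw [this, e]
      rw [this, Fin.val_succ, hτ, if_pos hi]
      have := hpos _ hi
      omega
    · have : pm σ i = 0 := pm_eq _ _ _ (fun _ _ => Fin.zero_le _) ⟨p, not_lt.1 hi, s1⟩
      rw [this]
      have := hm (not_lt.1 hi)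
      simp only [Fin.val_zero]
      omega

/-- Monotone sequences of length `s` with `z i ≤ i + a` and `z i ≤ b`. -/
noncomputable def Mset (s a b : ℕ) : Finset (Fin s → ℕ) :=
  (Fintype.piFinset fun i : Fin s => Finset.range (min (i + a) b + 1)).filter Monotone

lemma mem_Mset {s a b : ℕ} {z : Fin s → ℕ} :
    z ∈ Mset s a b ↔ Monotone z ∧ ∀ i, z i ≤ i + a ∧ z i ≤ b := by
  simp only [Mset, Finset.mem_filter, Fintype.mem_piFinset, Finset.mem_range, Nat.lt_succ_iff,
    le_min_iff]
  tauto

lemma card_Mset_succ (s a b : ℕ) (hb : b ≤ s + a) :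
    (Mset (s+1) a b).card = ∑ v ∈ Finset.range (b+1), (Mset s a v).card := by
  rw [Finset.card_eq_sum_card_fiberwise (f := fun z => z (Fin.last s)) (t := Finset.range (b+1))]
  · apply Finset.sum_congr rfl
    intro v hv
    have hv' : v ≤ b := by simpa [Nat.lt_succ_iff] using hv
    apply Finset.card_nbij' (fun z => Fin.init z) (fun z => Fin.snoc (α := fun _ => ℕ) z v)
    · intro z hz
      simp only [Finset.coe_filter, mem_Mset] at hz
      obtain ⟨⟨h1, h2⟩, h3⟩ := hz
      refine mem_Mset.2 ⟨fun i j hij => h1 hij, fun i => ⟨(h2 i.castSucc).1, ?_⟩⟩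
      rw [← h3]; exact h1 (Fin.le_last _)
    · intro z hz
      obtain ⟨h1, h2⟩ := mem_Mset.1 hz
      simp only [Finset.coe_filter, mem_Mset]
      refine ⟨⟨?_, ?_⟩, by simp⟩
      · intro i j hij
        induction j using Fin.lastCases with
        | last =>
          induction i using Fin.lastCases with
          | last => exact le_rfl
          | cast i => simpa using (h2 i).2
        | cast j =>
          induction i using Fin.lastCases with
          | last => exact absurd (Fin.castSucc_lt_last j) (not_lt.2 hij)
          | cast i => simpa using h1 (by simpa using hij)
      · intro i
        induction i using Fin.lastCases with
        | last => simp; omega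
        | cast i => simp; have := h2 i; omega
    · intro z hz
      simp only [Finset.coe_filter] at hz
      obtain ⟨_, h3⟩ := hz
      simp only [← h3]
      exact Fin.snoc_init_self z
    · intro z hz
      simp
  · intro z hz
    have := (mem_Mset.1 hz).2 (Fin.last s)
    simp; omega

lemma card_Mset (s a : ℕ) : ∀ b, b ≤ s + a →
    (Mset s a b).card + (s + b).choose (s + a + 1) = (s + b).choose s := by
  induction s with
  | zero =>
    intro b hb
    have : Mset 0 a b = {Fin.elim0} := by
      ext z
      simp only [mem_Mset, Finset.mem_singleton]
      exact ⟨fun _ => funext fun i => i.elim0, fun _ => ⟨fun i => i.elim0, fun i => i.elim0⟩⟩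
    rw [this, Nat.choose_eq_zero_of_lt (by omega)]
    simp
  | succ s ih =>
    have key : ∀ b, b ≤ s + a →
        (Mset (s+1) a b).card + (s + 1 + b).choose (s + 1 + a + 1) = (s + 1 + b).choose (s+1) := by
      intro b hb
      rw [card_Mset_succ s a b hb]
      induction b with
      | zero =>
        have := ih 0 (by omega)
        rw [Nat.choose_eq_zero_of_lt (by omega)] at this ⊢
        simpa using this
      | succ b ihb =>
        have h1 := ihb (by omega)
        have h2 := ih (b+1) (by omega)
        rw [Finset.sum_range_succ]
        have e1 : s + 1 + (b + 1) = (s + 1 + b) + 1 := by ring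
        have e2 : s + 1 + a + 1 = (s + a + 1) + 1 := by ring
        have e3 : s + (b + 1) = s + 1 + b := by ring
        rw [e1, e2, Nat.choose_succ_succ', Nat.choose_succ_succ' (s+1+b) s]
        rw [e2] at h1
        rw [e3] at h2
        omega
    intro b hb
    rcases Nat.lt_or_ge (s + a) b with h | h
    · have hb' : b = s + a + 1 := by omega
      subst hb'
      have h1 := key (s+a) le_rfl
      have : Mset (s+1) a (s+a+1) = Mset (s+1) a (s+a) := by
        ext z
        simp only [mem_Mset]
        refine and_congr_right fun _ => forall_congr' fun i => ?_
        have := i.2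
        omega
      rw [this]
      have e1 : s + 1 + (s + a + 1) = (s + 1 + (s + a)) + 1 := by ring
      have e2 : s + 1 + a + 1 = (s + a + 1) + 1 := by ring
      rw [e1, e2, Nat.choose_succ_succ', Nat.choose_succ_succ' (s + 1 + (s + a)) s]
      rw [e2] at h1
      have h3 : (s + 1 + (s + a)).choose (s + a + 1) = (s + 1 + (s + a)).choose s :=
        Nat.choose_symm_of_eq_add (by ring)
      omega
    · exact key b h

lemma card_M1 (r a : ℕ) : (Mset r a (r + a)).card * (r + a + 1) = (a + 1) * (2 * r + a).choose r := by
  have h := card_Mset r a (r + a) le_rfl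
  have h2 := Nat.choose_succ_right_eq (r + (r + a)) (r + a)
  have h3 : (r + (r + a)).choose (r + a) = (r + (r+a)).choose r :=
    Nat.choose_symm_of_eq_add (by ring)
  have e : r + (r + a) - (r + a) = r := by omega
  rw [e, h3] at h2
  have e2 : 2 * r + a = r + (r + a) := by ring
  rw [e2]
  have := congrArg (· * (r + a + 1)) h
  simp only [add_mul] at this
  nlinarith

lemma card_M2 (j h : ℕ) : (Mset (j + h) 0 j).card * (j + h + 1) = (h + 1) * (2 * j + h).choose j := by
  have h1 := card_Mset (j + h) 0 j (by omega)
  have h2 := Nat.choose_succ_right_eq (j + h + j) (j + h)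
  have h3 : (j + h + j).choose (j + h) = (j + h + j).choose j :=
    Nat.choose_symm_of_eq_add (by ring)
  have e : j + h + j - (j + h) = j := by omega
  rw [e, h3] at h2
  rw [h3] at h1
  have e2 : 2 * j + h = j + h + j := by ring
  rw [e2]
  simp only [add_zero] at h1
  have := congrArg (· * (j + h + 1)) h1
  simp only [add_mul] at this
  nlinarith

/-- the 123-avoiders -/
noncomputable def Av (n : ℕ) : Finset (Equiv.Perm (Fin n)) :=
  Finset.univ.filter (fun σ : Equiv.Perm (Fin n) => Avoids σ pattern123)

lemma mem_Av {n : ℕ} {σ : Equiv.Perm (Fin n)} : σ ∈ Av n ↔ Avoids σ pattern123 := by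
  simp [Av]

lemma card_Av_lower (n : ℕ) : n.centralBinom ≤ (Av n).card * (n + 1) := by
  have h := card_M2 n 0
  simp only [add_zero, zero_add, one_mul] at h
  rw [Nat.centralBinom, ← h]
  apply Nat.mul_le_mul_right
  have ex : ∀ z ∈ Mset n 0 n, ∃ σ ∈ Av n, ∀ i, (pm σ i : ℕ) = z i.rev := by
    intro z hz
    obtain ⟨h1, h2⟩ := mem_Mset.1 hz
    obtain ⟨σ, hσ⟩ := exists_perm_pm n (fun i => z i.rev)
      (fun i j hij => h1 (Fin.rev_le_rev.2 hij)) (fun i => by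
        have := (h2 i.rev).1
        rw [Fin.val_rev] at this
        have := i.2
        omega)
    obtain ⟨τ, h3, h4⟩ := exists_avoid123 σ
    exact ⟨τ, mem_Av.2 h3, fun i => by rw [h4]; exact hσ i⟩
  choose! f hf1 hf2 using ex
  apply Finset.card_le_card_of_injOn f hf1
  intro z hz w hw e
  funext i
  have a1 := hf2 z hz i.rev
  have a2 := hf2 w hw i.rev
  rw [e, a2] at a1
  simpa using a1.symm

lemma card_fiber (n r j h : ℕ) (hn : n = r + j + h + 1) (ρ : Fin n) (hρ : (ρ : ℕ) = r) :
    ((Av n).filter (fun σ => (pm σ ρ : ℕ) = j)).card ≤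
      (Mset r (h+1) (r + (h+1))).card * (Mset (j+h) 0 j).card := by
  rw [← Finset.card_product]
  let f : Equiv.Perm (Fin n) → (Fin r → ℕ) × (Fin (j+h) → ℕ) := fun σ =>
    (fun i => (pm σ ⟨r - 1 - i, by omega⟩ : ℕ) - j, fun i => (pm σ ⟨n - 1 - i, by omega⟩ : ℕ))
  apply Finset.card_le_card_of_injOn f
  · intro σ hσ
    simp only [Finset.coe_filter] at hσ
    obtain ⟨hσ, hj⟩ := hσ
    simp only [Finset.coe_product, Set.mem_prod, Finset.mem_coe, mem_Mset]
    refine ⟨⟨?_, ?_⟩, ?_, ?_⟩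
    · intro i k hik
      have h1 : (i : ℕ) ≤ k := hik
      have : (pm σ ⟨r - 1 - i, by omega⟩ : ℕ) ≤ pm σ ⟨r - 1 - k, by omega⟩ :=
        pm_antitone σ (Fin.mk_le_mk.2 (by omega))
      simp only [f]
      omega
    · intro i
      have := pm_bound σ ⟨r - 1 - i, by omega⟩
      simp only [f] at this ⊢
      omega
    · intro i k hik
      have h1 : (i : ℕ) ≤ k := hik
      have : (pm σ ⟨n - 1 - i, by omega⟩ : ℕ) ≤ pm σ ⟨n - 1 - k, by omega⟩ :=
        pm_antitone σ (Fin.mk_le_mk.2 (by omega))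
      simpa only [f] using this
    · intro i
      have := pm_bound σ ⟨n - 1 - i, by omega⟩
      have h2 : (pm σ ⟨n - 1 - i, by omega⟩ : ℕ) ≤ pm σ ρ :=
        pm_antitone σ (show ρ ≤ _ from Fin.le_def.2 (by simp only; omega))
      simp only [f] at this ⊢
      omega
  · intro σ hσ τ hτ e
    simp only [Finset.coe_filter] at hσ hτ
    obtain ⟨hσ, hj⟩ := hσ
    obtain ⟨hτ, hj'⟩ := hτ
    apply inj123 (mem_Av.1 hσ) (mem_Av.1 hτ)
    funext i
    apply Fin.ext
    simp only [f, Prod.mk.injEq] at e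
    rcases lt_trichotomy (i : ℕ) r with hi | hi | hi
    · have a1 := congrFun e.1 ⟨r - 1 - i, by omega⟩
      have a2 : (pm σ ρ : ℕ) ≤ pm σ i := pm_antitone σ (Fin.le_def.2 (by omega))
      have a3 : (pm τ ρ : ℕ) ≤ pm τ i := pm_antitone τ (Fin.le_def.2 (by omega))
      have a4 : (⟨r - 1 - (r - 1 - i), by omega⟩ : Fin n) = i := Fin.ext (by simp only; omega)
      simp only [a4] at a1
      omega
    · have : i = ρ := Fin.ext (by omega)
      rw [this]; omega
    · have a1 := congrFun e.2 ⟨n - 1 - i, by omega⟩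
      have a4 : (⟨n - 1 - (n - 1 - i), by omega⟩ : Fin n) = i := Fin.ext (by simp only; omega)
      simpa only [a4] using a1

lemma cb_lower (n : ℕ) (hn : 1 ≤ n) : 16 ^ n ≤ 4 * n * n.centralBinom ^ 2 := by
  induction n, hn using Nat.le_induction with
  | base => simp [Nat.centralBinom]
  | succ n hn ih =>
    have h := Nat.succ_mul_centralBinom_succ n
    have : (n+1) * (16 ^ (n+1)) ≤ (n+1) * (4 * (n+1) * (n+1).centralBinom ^ 2) := by
      calc (n+1) * (16 ^ (n+1)) = 16 * (n+1) * 16 ^ n := by ring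
        _ ≤ 16 * (n+1) * (4 * n * n.centralBinom ^ 2) := by gcongr
        _ = 16 * (4 * n * (n+1)) * n.centralBinom ^ 2 := by ring
        _ ≤ 16 * (2 * n + 1)^2 * n.centralBinom ^ 2 := by gcongr; nlinarith
        _ = 4 * (2 * (2 * n + 1) * n.centralBinom) ^ 2 := by ring
        _ = 4 * ((n+1) * (n+1).centralBinom) ^ 2 := by rw [h]
        _ = _ := by ring
    exact Nat.le_of_mul_le_mul_left this (by omega)

lemma cb_upper (n : ℕ) : (2 * n + 1) * n.centralBinom ^ 2 ≤ 16 ^ n := by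
  induction n with
  | zero => simp [Nat.centralBinom]
  | succ n ih =>
    have h := Nat.succ_mul_centralBinom_succ n
    have : (n+1)^2 * ((2 * (n+1) + 1) * (n+1).centralBinom ^ 2) ≤ (n+1)^2 * 16^(n+1) := by
      calc (n+1)^2 * ((2 * (n+1) + 1) * (n+1).centralBinom ^ 2)
          = (2*n+3) * ((n+1) * (n+1).centralBinom) ^ 2 := by ring
        _ = (2*n+3) * (2 * (2 * n + 1) * n.centralBinom) ^ 2 := by rw [h]
        _ = 4 * (2*n+3) * (2*n+1) * ((2 * n + 1) * n.centralBinom ^ 2) := by ring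
        _ ≤ 4 * (2*n+3) * (2*n+1) * 16 ^ n := by gcongr
        _ = (4 * ((2*n+3) * (2*n+1))) * 16 ^ n := by ring
        _ ≤ (16 * (n+1)^2) * 16 ^ n := by
          apply Nat.mul_le_mul_right; nlinarith
        _ = _ := by ring
    exact Nat.le_of_mul_le_mul_left this (by positivity)

lemma choose_sq_le (N k : ℕ) : N * (N.choose k) ^ 2 ≤ 4 ^ N := by
  have h0 := Nat.choose_le_middle k N
  refine (Nat.mul_le_mul_left N (Nat.pow_le_pow_left h0 2)).trans ?_
  rcases Nat.even_or_odd' N with ⟨m, rfl | rfl⟩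
  · have := cb_upper m
    rw [Nat.centralBinom] at this
    rw [show 2 * m / 2 = m by omega, pow_mul]
    norm_num
    nlinarith
  · have := cb_upper (m+1)
    rw [Nat.centralBinom, show 2 * (m+1) = (2 * m + 1) + 1 by ring, Nat.choose_succ_succ',
      Nat.choose_symm_of_eq_add (show 2 * m + 1 = (m+1) + m by ring)] at this
    rw [show (2 * m + 1) / 2 = m by omega, pow_succ 4, pow_mul]
    rw [pow_succ 16] at this
    norm_num
    nlinarith

lemma choose_le_real (N k : ℕ) (y : ℝ) (hy : 0 < y) (h : y ≤ N) :
    (N.choose k : ℝ) ≤ 2 ^ N / Real.sqrt y := by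
  rw [le_div_iff₀ (Real.sqrt_pos.2 hy)]
  apply abs_le_of_sq_le_sq' _ (by positivity) |>.2
  rw [mul_pow, Real.sq_sqrt hy.le]
  have := choose_sq_le N k
  have h2 : (N : ℝ) * (N.choose k : ℝ) ^ 2 ≤ 4 ^ N := by exact_mod_cast this
  calc (N.choose k : ℝ) ^ 2 * y ≤ (N.choose k : ℝ) ^ 2 * N := by gcongr
    _ ≤ 4 ^ N := by linarith
    _ = (2 ^ N) ^ 2 := by rw [← pow_mul, mul_comm, pow_mul]; norm_num

lemma chernoff (r a : ℕ) (ha : 0 < a) :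
    ((2 * r + a).choose r : ℝ) ≤
      2 ^ (2 * r + a) * Real.exp (-((a : ℝ) ^ 2 / (2 * (2 * r + a : ℕ)))) := by
  set N := 2 * r + a with hN
  have hNpos : (0 : ℝ) < N := by exact_mod_cast (show 0 < N by omega)
  set s : ℝ := a / N with hs
  have h1 : (N.choose r : ℝ) * Real.exp (s * a) ≤ (Real.exp (-s) + Real.exp s) ^ N := by
    rw [add_pow]
    have : (N.choose r : ℝ) * Real.exp (s * a) =
        Real.exp (-s) ^ r * Real.exp s ^ (N - r) * (N.choose r : ℝ) := by
      rw [← Real.exp_nat_mul, ← Real.exp_nat_mul, ← Real.exp_add, mul_comm]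
      congr 2
      rw [Nat.cast_sub (by omega), hN]
      push_cast; ring
    rw [this]
    apply Finset.single_le_sum (f := fun m => Real.exp (-s) ^ m * Real.exp s ^ (N - m) * (N.choose m : ℝ))
    · intro i _; positivity
    · simp; omega
  have h2 : Real.exp (-s) + Real.exp s ≤ 2 * Real.exp (s^2/2) := by
    have := Real.cosh_le_exp_half_sq s
    rw [Real.cosh_eq] at this
    linarith
  have h3 : (N.choose r : ℝ) * Real.exp (s * a) ≤ 2 ^ N * Real.exp (N * (s^2/2)) := by
    refine h1.trans ((pow_le_pow_left₀ (by positivity) h2 N).trans ?_)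
    rw [mul_pow, Real.exp_nat_mul]
  have h4 : (N.choose r : ℝ) = (N.choose r : ℝ) * Real.exp (s * a) * Real.exp (-(s*a)) := by
    rw [mul_assoc, ← Real.exp_add]; simp
  rw [h4]
  calc _ ≤ 2 ^ N * Real.exp (N * (s^2/2)) * Real.exp (-(s*a)) := by gcongr
    _ = _ := by
      rw [mul_assoc, ← Real.exp_add]
      congr 2
      rw [hs]; field_simp; ring

lemma four_pow_le (n : ℕ) (hn : 1 ≤ n) :
    (4 : ℝ) ^ n ≤ 4 * n * Real.sqrt n * (Av n).card := by
  have h1 : ((16 : ℝ)) ^ n ≤ 4 * n * (n.centralBinom : ℝ) ^ 2 := by exact_mod_cast cb_lower n hn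
  have h2 : (n.centralBinom : ℝ) ≤ (Av n).card * (n + 1) := by exact_mod_cast card_Av_lower n
  have hn' : (1 : ℝ) ≤ n := by exact_mod_cast hn
  have h3 : (4 : ℝ) ^ n ≤ 2 * Real.sqrt n * n.centralBinom := by
    apply abs_le_of_sq_le_sq' _ (by positivity) |>.2
    rw [mul_pow, mul_pow, Real.sq_sqrt (by positivity), ← pow_mul, mul_comm n 2, pow_mul]
    norm_num; linarith
  calc (4 : ℝ) ^ n ≤ 2 * Real.sqrt n * n.centralBinom := h3
    _ ≤ 2 * Real.sqrt n * ((Av n).card * (n + 1)) := by gcongr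
    _ ≤ 2 * Real.sqrt n * ((Av n).card * (n + n)) := by gcongr
    _ = _ := by ring

lemma rank_set_lt {n : ℕ} {lam : ℝ} (hlam : 0 < lam) (hn : 1 ≤ n) (hl : 1 ≤ lam * n)
    (σ : Equiv.Perm (Fin n)) (r : ℕ)
    (hr : ∀ i : Fin n, (i : ℕ) + 1 ≤ r → lam * r < (pm σ i : ℕ) + 1) : r < n := by
  by_contra hc
  have h := hr ⟨n - 1, by omega⟩ (by simp only; omega)
  have h2 := pm_bound σ ⟨n - 1, by omega⟩
  have h3 : (pm σ ⟨n - 1, by omega⟩ : ℕ) = 0 := by simp only at h2; omega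
  rw [h3] at h
  have : (n : ℝ) ≤ r := by exact_mod_cast not_lt.1 hc
  have := mul_le_mul_of_nonneg_left this hlam.le
  simp at h
  linarith

lemma le_rank_iff {n : ℕ} {lam : ℝ} (hlam : 0 < lam) (hn : 1 ≤ n) (hl : 1 ≤ lam * n)
    (σ : Equiv.Perm (Fin n)) (r : ℕ) (hr : 1 ≤ r) (hrn : r ≤ n) :
    r ≤ rankStat lam σ ↔ lam * r < (pm σ ⟨r - 1, by omega⟩ : ℕ) + 1 := by
  rw [rankStat_eq]
  have hbdd : BddAbove {r : ℕ | ∀ i : Fin n, (i : ℕ) + 1 ≤ r → lam * r < (pm σ i : ℕ) + 1} :=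
    ⟨n, fun r hr => (rank_set_lt hlam hn hl σ r hr).le⟩
  constructor
  · intro h
    have hm := Nat.sSup_mem ⟨0, by intro i hi; omega⟩ hbdd
    have := hm ⟨r - 1, by omega⟩ (by simp only; omega)
    refine lt_of_le_of_lt ?_ this
    gcongr
  · intro h
    apply le_csSup hbdd
    intro i hi
    refine h.trans_le ?_
    have : (pm σ ⟨r - 1, by omega⟩ : ℕ) ≤ pm σ i :=
      pm_antitone σ (Fin.le_def.2 (by simp only; omega))
    exact_mod_cast Nat.succ_le_succ this

lemma rank_lt {n : ℕ} {lam : ℝ} (hlam : 0 < lam) (hn : 1 ≤ n) (hl : 1 ≤ lam * n)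
    (σ : Equiv.Perm (Fin n)) : rankStat lam σ < n := by
  rw [rankStat_eq]
  have hbdd : BddAbove {r : ℕ | ∀ i : Fin n, (i : ℕ) + 1 ≤ r → lam * r < (pm σ i : ℕ) + 1} :=
    ⟨n, fun r hr => (rank_set_lt hlam hn hl σ r hr).le⟩
  exact rank_set_lt hlam hn hl σ _ (Nat.sSup_mem ⟨0, by intro i hi; omega⟩ hbdd)

lemma rankStat_le {n : ℕ} {lam : ℝ} (hlam : 0 < lam) (hn : 1 ≤ n) (hl : 1 ≤ lam * n)
    (σ : Equiv.Perm (Fin n)) : (rankStat lam σ : ℝ) ≤ (n + 1) / (lam + 1) := by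
  have hlt := rank_lt hlam hn hl σ
  rw [le_div_iff₀ (by linarith)]
  rcases Nat.eq_zero_or_pos (rankStat lam σ) with h | h
  · rw [h]; simp; positivity
  · have h1 := (le_rank_iff hlam hn hl σ _ h hlt.le).1 le_rfl
    have h2 := pm_bound σ ⟨rankStat lam σ - 1, by omega⟩
    simp only at h2
    have h3 : (pm σ ⟨rankStat lam σ - 1, by omega⟩ : ℕ) + rankStat lam σ ≤ n := by omega
    have h4 : ((pm σ ⟨rankStat lam σ - 1, by omega⟩ : ℕ) : ℝ) + rankStat lam σ ≤ n := by
      exact_mod_cast h3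
    linarith

/-- fiberwise bound of a subset of the avoiders -/
lemma card_le_of_fibers {n r : ℕ} (hr : 1 ≤ r) (hrn : r ≤ n) (B : Finset (Equiv.Perm (Fin n)))
    (hB : B ⊆ Av n) (t : Finset ℕ) (b : ℝ)
    (ht : ∀ σ ∈ B, n - r - (pm σ ⟨r - 1, by omega⟩ : ℕ) ∈ t)
    (hb : ∀ h ∈ t, r + h ≤ n → ((Mset (r-1) (h+1) (r - 1 + (h+1))).card : ℝ) *
      ((Mset (n - r - h + h) 0 (n - r - h)).card : ℝ) ≤ b) (hb0 : 0 ≤ b) :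
    (B.card : ℝ) ≤ t.card * b := by
  rw [Finset.card_eq_sum_card_fiberwise (f := fun σ => n - r - (pm σ ⟨r - 1, by omega⟩ : ℕ)) (t := t)
    ht]
  push_cast
  rw [← nsmul_eq_mul]
  apply Finset.sum_le_card_nsmul
  intro h hh
  by_cases hle : r + h ≤ n
  · refine le_trans ?_ (hb h hh hle)
    have := card_fiber n (r-1) (n - r - h) h (by omega) ⟨r - 1, by omega⟩ rfl
    norm_cast
    refine le_trans ?_ this
    apply Finset.card_le_card
    intro σ hσ
    rw [Finset.mem_filter] at hσ ⊢
    refine ⟨hB hσ.1, ?_⟩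
    have h2 := pm_bound σ ⟨r - 1, by omega⟩
    have h3 := hσ.2
    simp only at h2
    omega
  · have : B.filter (fun σ => n - r - (pm σ ⟨r - 1, by omega⟩ : ℕ) = h) = ∅ := by
      rw [Finset.filter_eq_empty_iff]
      intro σ _
      omega
    rw [this]; simpa using hb0

lemma upper_term {n r h : ℕ} (hr : 1 ≤ r) (hrn : r + h ≤ n) (y : ℝ) (hy : 0 < y)
    (h1 : y ≤ r) (h2 : y ≤ n - r) :
    ((Mset (r-1) (h+1) (r - 1 + (h+1))).card : ℝ) *
      ((Mset (n - r - h + h) 0 (n - r - h)).card : ℝ) ≤ ((h : ℝ) + 2) ^ 2 * 4 ^ n / (2 * y ^ 3) := by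
  obtain ⟨q, rfl⟩ : ∃ q, r = q + 1 := ⟨r - 1, by omega⟩
  obtain ⟨j, rfl⟩ : ∃ j, n = q + 1 + h + j := ⟨n - (q + 1 + h), by omega⟩
  have e1 : q + 1 + h + j - (q + 1) - h = j := by omega
  rw [e1, Nat.add_sub_cancel]
  push_cast at h1 h2
  have m1 : ((Mset q (h+1) (q + (h+1))).card : ℝ) * (q + (h+1) + 1) =
      ((h : ℝ) + 1 + 1) * ((2 * q + (h+1)).choose q : ℝ) := by exact_mod_cast card_M1 q (h+1)
  have m2 : ((Mset (j+h) 0 j).card : ℝ) * (j + h + 1) =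
      ((h : ℝ) + 1) * ((2 * j + h).choose j : ℝ) := by exact_mod_cast card_M2 j h
  have hh0 : (0 : ℝ) ≤ h := by positivity
  have hq0 : (0 : ℝ) ≤ q := by positivity
  have hj0 : (0 : ℝ) ≤ j := by positivity
  have c1 := choose_le_real (2 * q + (h+1)) q y hy (by push_cast; linarith)
  have c2 := choose_le_real (2 * j + h) j y hy (by push_cast; linarith)
  have b1 : ((Mset q (h+1) (q + (h+1))).card : ℝ) * y ≤
      ((h : ℝ) + 2) * (2 ^ (2 * q + (h+1)) / Real.sqrt y) := by
    calc _ ≤ ((Mset q (h+1) (q + (h+1))).card : ℝ) * (q + (h+1) + 1) := by gcongr; linarith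
      _ = ((h : ℝ) + 1 + 1) * ((2 * q + (h+1)).choose q : ℝ) := m1
      _ ≤ ((h : ℝ) + 1 + 1) * (2 ^ (2 * q + (h+1)) / Real.sqrt y) := by gcongr
      _ = _ := by ring
  have b2 : ((Mset (j+h) 0 j).card : ℝ) * y ≤ ((h : ℝ) + 2) * (2 ^ (2 * j + h) / Real.sqrt y) := by
    calc _ ≤ ((Mset (j+h) 0 j).card : ℝ) * (j + h + 1) := by gcongr; linarith
      _ = ((h : ℝ) + 1) * ((2 * j + h).choose j : ℝ) := m2
      _ ≤ ((h : ℝ) + 2) * (2 ^ (2 * j + h) / Real.sqrt y) := by gcongr; norm_num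
  have b3 := mul_le_mul b1 b2 (by positivity) (by positivity)
  have hs : Real.sqrt y * Real.sqrt y = y := Real.mul_self_sqrt hy.le
  have hsp : 0 < Real.sqrt y := Real.sqrt_pos.2 hy
  have b4 : ((h : ℝ) + 2) * (2 ^ (2 * q + (h+1)) / Real.sqrt y) *
      (((h : ℝ) + 2) * (2 ^ (2 * j + h) / Real.sqrt y)) =
      ((h : ℝ) + 2) ^ 2 * 4 ^ (q + 1 + h + j) / (2 * y) := by
    have : (4 : ℝ) ^ (q + 1 + h + j) = 2 * (2 ^ (2 * q + (h+1)) * 2 ^ (2 * j + h)) := by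
      rw [show (4 : ℝ) = 2 ^ 2 by norm_num, ← pow_mul, ← pow_add, ← pow_succ']
      congr 1; ring
    rw [this]
    have hs2 : Real.sqrt y ^ 2 = y := Real.sq_sqrt hy.le
    field_simp
    rw [hs2]
  rw [b4] at b3
  rw [le_div_iff₀ (by positivity)]
  rw [le_div_iff₀ (by positivity)] at b3
  linarith

lemma lower_term {n r h : ℕ} (hr : 1 ≤ r) (hrn : r + h ≤ n) (G : ℝ) (hG : 0 ≤ G) (hGh : G ≤ h) :
    ((Mset (r-1) (h+1) (r - 1 + (h+1))).card : ℝ) *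
      ((Mset (n - r - h + h) 0 (n - r - h)).card : ℝ) ≤ 4 ^ n / 2 * Real.exp (-(G ^ 2 / (4 * n))) := by
  obtain ⟨q, rfl⟩ : ∃ q, r = q + 1 := ⟨r - 1, by omega⟩
  obtain ⟨j, rfl⟩ : ∃ j, n = q + 1 + h + j := ⟨n - (q + 1 + h), by omega⟩
  have e1 : q + 1 + h + j - (q + 1) - h = j := by omega
  rw [e1, Nat.add_sub_cancel]
  have m1 : ((Mset q (h+1) (q + (h+1))).card : ℝ) ≤ ((2 * q + (h+1)).choose q : ℝ) := by
    have := card_Mset q (h+1) (q + (h+1)) le_rfl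
    rw [show q + (q + (h+1)) = 2 * q + (h+1) by ring] at this
    exact_mod_cast (by omega)
  have m2 : ((Mset (j+h) 0 j).card : ℝ) ≤ 2 ^ (2 * j + h) := by
    have := card_Mset (j+h) 0 j (by omega)
    have h2 := Nat.choose_le_two_pow (j+h+j) (j+h)
    rw [show j + h + j = 2 * j + h by ring] at this h2
    exact_mod_cast (by omega)
  have c1 := chernoff q (h+1) (by omega)
  have c2 : Real.exp (-(((h+1 : ℕ) : ℝ) ^ 2 / (2 * (2 * q + (h+1) : ℕ)))) ≤
      Real.exp (-(G ^ 2 / (4 * (q + 1 + h + j : ℕ)))) := by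
    apply Real.exp_le_exp.2
    apply neg_le_neg
    apply div_le_div₀ (by positivity) _ (by positivity) _
    · push_cast; gcongr; linarith
    · push_cast
      have hh0 : (0 : ℝ) ≤ h := by positivity
      have hj0 : (0 : ℝ) ≤ j := by positivity
      linarith
  have : (4 : ℝ) ^ (q + 1 + h + j) / 2 = (2 ^ (2 * q + (h+1)) * 2 ^ (2 * j + h)) := by
    rw [div_eq_iff (by norm_num), show (4 : ℝ) = 2 ^ 2 by norm_num, ← pow_mul, ← pow_add, ← pow_succ]
    congr 1; ring
  rw [this]
  calc _ ≤ (2 ^ (2 * q + (h+1)) * Real.exp (-(G ^ 2 / (4 * (q + 1 + h + j : ℕ))))) * 2 ^ (2 * j + h) := by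
        gcongr
        exact m1.trans (c1.trans (by gcongr))
    _ = _ := by ring

lemma upper_bound (lam : ℝ) (hlam : 0 < lam) : ∃ c : ℝ, 0 < c ∧ ∀ᶠ n : ℕ in atTop,
    ERank123 lam n ≤ (n : ℝ) / (lam + 1) - c * Real.sqrt n := by
  have hl1 : 0 < lam + 1 := by linarith
  obtain ⟨β, hβ0, hβ1, hβ2⟩ : ∃ β : ℝ, 0 < β ∧ β * (2 * (lam + 1)) ≤ 1 ∧ β * (lam + 1) ≤ lam := by
    refine ⟨min 1 lam / (2 * (lam + 1)), by positivity, ?_, ?_⟩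
    · rw [div_mul_cancel₀ _ (by positivity)]; exact min_le_left _ _
    · have : min 1 lam / (2 * (lam + 1)) * (lam + 1) = min 1 lam / 2 := by field_simp
      rw [this]
      have := min_le_right 1 lam
      linarith
  set c : ℝ := β / (4 * (lam + 1)) with hc
  have hc0 : 0 < c := by positivity
  have hcβ : c * (lam + 1) = β / 4 := by rw [hc]; field_simp
  refine ⟨c / 4, by positivity, ?_⟩
  have t1 : Tendsto (fun n : ℕ => (n : ℝ)) atTop atTop := tendsto_natCast_atTop_atTop
  have t2 : Tendsto (fun n : ℕ => Real.sqrt n) atTop atTop := Real.tendsto_sqrt_atTop.comp t1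
  filter_upwards [t1.eventually_ge_atTop 1, t1.eventually_ge_atTop (1 / lam),
    t2.eventually_ge_atTop (3 / ((lam + 1) * c)), t2.eventually_ge_atTop (4 / c),
    t2.eventually_ge_atTop (2 * (lam + 1) * c)] with n hn1 hn2 hn3 hn4 hn5
  have hn : 1 ≤ n := by exact_mod_cast hn1
  have hl : 1 ≤ lam * n := by rw [div_le_iff₀ hlam] at hn2; linarith
  set w := Real.sqrt n with hw
  have hww : w * w = n := Real.mul_self_sqrt (by positivity)
  have hw0 : 0 < w := by positivity
  rw [div_le_iff₀ (by positivity)] at hn3 hn4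
  set x : ℝ := n / (lam + 1) - c * w with hx
  have hxl : x * (lam + 1) = n - c * (lam + 1) * w := by rw [hx]; field_simp
  have hx1 : n ≤ 2 * (lam + 1) * x := by
    have := mul_le_mul_of_nonneg_right hn5 hw0.le
    nlinarith
  have hx0 : 0 < x := by
    by_contra hcon
    nlinarith
  set r := ⌈x⌉₊ with hr
  have hr1 : 1 ≤ r := Nat.ceil_pos.2 hx0
  have hrx : x ≤ r := Nat.le_ceil x
  have hrx2 : (r : ℝ) < x + 1 := Nat.ceil_lt_add_one hx0.le
  have hrle : (r : ℝ) ≤ n / (lam + 1) := by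
    have : x + 1 ≤ n / (lam + 1) := by rw [hx]; linarith
    linarith
  have hrle' : (r : ℝ) * (lam + 1) ≤ n := by rwa [le_div_iff₀ hl1] at hrle
  have hrn : r ≤ n := by
    have : (r : ℝ) ≤ n := by nlinarith
    exact_mod_cast this
  set B := (Av n).filter (fun σ => r ≤ rankStat lam σ) with hB
  set K := ⌈(n : ℝ) + 1 - (lam + 1) * r⌉₊ with hK
  have hKlt : (K : ℝ) + 1 ≤ β / 2 * w := by
    have h1 : (K : ℝ) < (n : ℝ) + 1 - (lam + 1) * r + 1 := Nat.ceil_lt_add_one (by linarith)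
    have h2 : (lam + 1) * x ≤ (lam + 1) * r := by gcongr
    nlinarith
  have hy0 : 0 < β * n := by positivity
  have hBcard : (B.card : ℝ) ≤ (Finset.range K).card *
      ((β / 2 * w) ^ 2 * 4 ^ n / (2 * (β * n) ^ 3)) := by
    apply card_le_of_fibers hr1 hrn B (Finset.filter_subset _ _)
    · intro σ hσ
      rw [Finset.mem_range]
      have h1 := (Finset.mem_filter.1 hσ).2
      rw [le_rank_iff hlam hn hl σ r hr1 hrn] at h1
      have h2 := pm_bound σ ⟨r - 1, by omega⟩
      simp only at h2
      set j := (pm σ ⟨r - 1, by omega⟩ : ℕ) with hj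
      have h3 : j + r ≤ n := by omega
      apply Nat.lt_ceil.2
      rw [Nat.cast_sub (by omega), Nat.cast_sub (by omega)]
      linarith
    · intro h hh hle
      rw [Finset.mem_range] at hh
      refine (upper_term hr1 hle (β * n) hy0 ?_ ?_).trans ?_
      · nlinarith
      · nlinarith
      · have h5 : (h : ℝ) + 1 ≤ K := by exact_mod_cast hh
        gcongr
        linarith
    · positivity
  have h4 := four_pow_le n hn
  set T : ℝ := ((Av n).card : ℝ) with hT
  rw [Finset.card_range] at hBcard
  have hT0 : 0 < T := by
    by_contra hcon
    have : T = 0 := le_antisymm (not_lt.1 hcon) (by positivity)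
    rw [this] at h4
    have : (0 : ℝ) < 4 ^ n := by positivity
    linarith
  have hBT : (B.card : ℝ) ≤ T / 2 := by
    calc (B.card : ℝ) ≤ K * ((β / 2 * w) ^ 2 * 4 ^ n / (2 * (β * n) ^ 3)) := hBcard
      _ ≤ (β / 2 * w) * ((β / 2 * w) ^ 2 * (4 * n * w * T) / (2 * (β * n) ^ 3)) := by
        gcongr; linarith
      _ = T / 4 * ((w * w) * (w * w) / (n * n)) := by
        field_simp; ring
      _ = T / 4 := by rw [hww]; field_simp
      _ ≤ T / 2 := by linarith
  have hE : ERank123 lam n = (∑ σ ∈ Av n, (rankStat lam σ : ℝ)) / T := rfl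
  rw [hE, div_le_iff₀ hT0]
  have hsum : ∑ σ ∈ Av n, (rankStat lam σ : ℝ) ≤
      ∑ σ ∈ Av n, ((r : ℝ) + if r ≤ rankStat lam σ then ((n + 1) / (lam + 1) - r : ℝ) else 0) := by
    apply Finset.sum_le_sum
    intro σ _
    split_ifs with h
    · have := rankStat_le hlam hn hl σ
      linarith
    · push Not at h
      have : (rankStat lam σ : ℝ) ≤ r := by exact_mod_cast h.le
      linarith
  refine hsum.trans ?_
  rw [Finset.sum_add_distrib, Finset.sum_const, ← Finset.sum_filter, Finset.sum_const,
    nsmul_eq_mul, nsmul_eq_mul]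
  change T * r + (B.card : ℝ) * _ ≤ _
  have hd : ((n : ℝ) + 1) / (lam + 1) = n / (lam + 1) + 1 / (lam + 1) := by ring
  have hd2 : 1 / (lam + 1) ≤ 1 := by rw [div_le_one hl1]; linarith
  have hd3 : 0 < 1 / (lam + 1) := by positivity
  have hnn : 0 ≤ ((n : ℝ) + 1) / (lam + 1) - r := by rw [hd]; linarith
  have h7 := mul_le_mul_of_nonneg_right hBT hnn
  have h8 : ((r : ℝ) + ((n + 1) / (lam + 1))) / 2 ≤ n / (lam + 1) - c / 4 * w := by
    rw [hd]
    linarith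
  have h9 := mul_le_mul_of_nonneg_right h8 hT0.le
  linarith

set_option maxHeartbeats 1000000 in
lemma lower_bound (lam : ℝ) (hlam : 0 < lam) (c₁ : ℝ) (hc₁ : 0 < c₁) (ε : ℝ) (hε : 0 < ε) :
    ∀ᶠ n : ℕ in atTop,
    (n : ℝ) / (lam + 1) - c₁ * (n : ℝ) ^ ((1 : ℝ) / 2 + ε) ≤ ERank123 lam n := by
  have hl1 : 0 < lam + 1 := by linarith
  have t1 : Tendsto (fun n : ℕ => (n : ℝ)) atTop atTop := tendsto_natCast_atTop_atTop
  have t2 : Tendsto (fun n : ℕ => (n : ℝ) ^ ((1 : ℝ) / 2 + ε)) atTop atTop :=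
    (tendsto_rpow_atTop (by linarith)).comp t1
  have t3 : Tendsto (fun n : ℕ => (n : ℝ) ^ (2 * ε)) atTop atTop :=
    (tendsto_rpow_atTop (by linarith)).comp t1
  set κ : ℝ := ((lam + 1) * (c₁ / 2)) ^ 2 / 4 with hκ
  have hκ0 : 0 < κ := by positivity
  have t4 := (tendsto_rpow_mul_exp_neg_mul_atTop_nhds_zero (2 / ε) κ hκ0).comp t3
  filter_upwards [t1.eventually_ge_atTop 1, t1.eventually_ge_atTop (1 / lam),
    t2.eventually_ge_atTop (4 / c₁), t4.eventually_le_const (show (0 : ℝ) < 1 / 2 by norm_num)]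
    with n hn1 hn2 hn3 hn4
  have hn : 1 ≤ n := by exact_mod_cast hn1
  have hl : 1 ≤ lam * n := by rw [div_le_iff₀ hlam] at hn2; linarith
  have hn0 : (0 : ℝ) < n := by linarith
  simp only [Function.comp] at hn4
  have hp : ((n : ℝ) ^ (2 * ε)) ^ (2 / ε) = (n : ℝ) ^ 4 := by
    rw [← Real.rpow_mul hn0.le, show 2 * ε * (2 / ε) = ((4 : ℕ) : ℝ) by field_simp; norm_num,
      Real.rpow_natCast]
  rw [hp] at hn4
  rw [div_le_iff₀ hc₁] at hn3
  set u : ℝ := (n : ℝ) ^ ((1 : ℝ) / 2 + ε) with hu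
  have hu0 : 0 < u := by positivity
  have huu : u ^ 2 = n * (n : ℝ) ^ (2 * ε) := by
    rw [hu, ← Real.rpow_natCast, ← Real.rpow_mul hn0.le]
    nth_rw 2 [← Real.rpow_one (n : ℝ)]
    rw [← Real.rpow_add hn0]
    congr 1
    push_cast; ring
  have h4 := four_pow_le n hn
  set T : ℝ := ((Av n).card : ℝ) with hT
  have hT0 : 0 < T := by
    by_contra hcon
    have : T = 0 := le_antisymm (not_lt.1 hcon) (by positivity)
    rw [this] at h4
    have : (0 : ℝ) < 4 ^ n := by positivity
    linarith
  have hE : ERank123 lam n = (∑ σ ∈ Av n, (rankStat lam σ : ℝ)) / T := rfl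
  set x : ℝ := n / (lam + 1) - c₁ / 2 * u with hx
  rcases lt_or_ge x 1 with hx1 | hx1
  · have : 0 ≤ ERank123 lam n := by rw [hE]; positivity
    linarith
  set r := ⌊x⌋₊ with hr
  have hrx : (r : ℝ) ≤ x := Nat.floor_le (by linarith)
  have hrx2 : x < r + 1 := Nat.lt_floor_add_one x
  have hr1 : 1 ≤ r := Nat.le_floor (by simpa using hx1)
  have hxl : x * (lam + 1) = n - (lam + 1) * (c₁ / 2) * u := by rw [hx]; field_simp
  set G : ℝ := (lam + 1) * (c₁ / 2) * u with hG
  have hG0 : 0 < G := by positivity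
  have hrl : (r : ℝ) * (lam + 1) ≤ n - G := by
    rw [← hxl]; gcongr
  have hrn' : (r : ℝ) ≤ n := by nlinarith
  have hrn : r ≤ n := by exact_mod_cast hrn'
  set B := (Av n).filter (fun σ => ¬ r ≤ rankStat lam σ) with hB
  have hBcard : (B.card : ℝ) ≤ ((Finset.range n).filter (fun h : ℕ => G ≤ (h : ℝ))).card *
      (4 ^ n / 2 * Real.exp (-(G ^ 2 / (4 * n)))) := by
    apply card_le_of_fibers hr1 hrn B (Finset.filter_subset _ _)
    · intro σ hσ
      have h1 := (Finset.mem_filter.1 hσ).2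
      rw [le_rank_iff hlam hn hl σ r hr1 hrn] at h1
      have h2 := pm_bound σ ⟨r - 1, by omega⟩
      simp only at h2
      set j := (pm σ ⟨r - 1, by omega⟩ : ℕ) with hj
      rw [Finset.mem_filter, Finset.mem_range]
      refine ⟨by omega, ?_⟩
      rw [Nat.cast_sub (by omega), Nat.cast_sub (by omega)]
      push Not at h1
      linarith
    · intro h hh hle
      exact lower_term hr1 hle G hG0.le (Finset.mem_filter.1 hh).2
    · positivity
  have hcard : (((Finset.range n).filter (fun h : ℕ => G ≤ (h : ℝ))).card : ℝ) ≤ n := by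
    have := Finset.card_filter_le (Finset.range n) (fun h : ℕ => G ≤ (h : ℝ))
    rw [Finset.card_range] at this
    exact_mod_cast this
  have hexp : G ^ 2 / (4 * n) = κ * (n : ℝ) ^ (2 * ε) := by
    rw [hG, mul_pow, huu, hκ]
    field_simp
  rw [hexp, ← neg_mul] at hBcard
  set X := Real.exp (-κ * (n : ℝ) ^ (2 * ε)) with hX
  have hX0 : 0 < X := Real.exp_pos _
  have hsq : Real.sqrt n ≤ n := by
    rw [Real.sqrt_le_left hn0.le]; nlinarith
  have hBT : (B.card : ℝ) * n ≤ T := by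
    calc (B.card : ℝ) * n ≤ (n * (4 ^ n / 2 * X)) * n := by
          gcongr
          exact hBcard.trans (by gcongr)
      _ ≤ (n * ((4 * n * Real.sqrt n * T) / 2 * X)) * n := by gcongr
      _ ≤ (n * ((4 * n * n * T) / 2 * X)) * n := by gcongr
      _ = 2 * T * (n ^ 4 * X) := by ring
      _ ≤ 2 * T * (1 / 2) := by gcongr
      _ = T := by ring
  have hsum : ∑ σ ∈ Av n, ((r : ℝ) - if ¬ r ≤ rankStat lam σ then (r : ℝ) else 0) ≤
      ∑ σ ∈ Av n, (rankStat lam σ : ℝ) := by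
    apply Finset.sum_le_sum
    intro σ _
    by_cases h : r ≤ rankStat lam σ
    · rw [if_neg (not_not.2 h)]
      have : (r : ℝ) ≤ rankStat lam σ := by exact_mod_cast h
      linarith
    · rw [if_pos h]
      simp
  rw [Finset.sum_sub_distrib, Finset.sum_const, ← Finset.sum_filter, Finset.sum_const,
    nsmul_eq_mul, nsmul_eq_mul] at hsum
  change T * r - (B.card : ℝ) * r ≤ _ at hsum
  rw [hE, le_div_iff₀ hT0]
  refine le_trans ?_ hsum
  have h5 : (B.card : ℝ) * r ≤ T := le_trans (by gcongr) hBT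
  have h6 : (n : ℝ) / (lam + 1) - c₁ * u ≤ r - 1 := by linarith
  have h7 := mul_le_mul_of_nonneg_right h6 hT0.le
  linarith

/-- Fix `λ > 0`, and let `E_n` be the expected `rank_λ` of a uniform `123`-avoiding
permutation. (i) For `λ = 1`, the expectations over `S_n(123)` and `S_n(132)` agree for
every `n`. (ii) For every `c₁ > 0` and `ε ∈ (0,1/2)` there is `c₂ > 0` such that for
all sufficiently large `n`, `n/(λ+1) − c₁ n^{1/2+ε} ≤ E_n ≤ n/(λ+1) − c₂ √n`. -/
theorem expected_rank (lam : ℝ) (hlam : 0 < lam) :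
    (∀ n : ℕ, ERank123 1 n = ERank132 1 n) ∧
    (∀ c₁ : ℝ, 0 < c₁ → ∀ ε : ℝ, 0 < ε → ε < 1 / 2 →
      ∃ c₂ : ℝ, 0 < c₂ ∧ ∃ N : ℕ, ∀ n : ℕ, N ≤ n →
        (n : ℝ) / (lam + 1) - c₁ * (n : ℝ) ^ ((1 : ℝ) / 2 + ε) ≤ ERank123 lam n ∧
        ERank123 lam n ≤ (n : ℝ) / (lam + 1) - c₂ * Real.sqrt n) := by

  refine ⟨part_one 1, fun c₁ hc₁ ε hε _ => ?_⟩
  obtain ⟨c₂, hc₂, hU⟩ := upper_bound lam hlam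
  obtain ⟨N, hN⟩ := eventually_atTop.1 ((lower_bound lam hlam c₁ hc₁ ε hε).and hU)
  exact ⟨c₂, hc₂, N, hN⟩
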